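/- arXiv:2106.14753 — 5 statements merged into one kernel-verified Lean document; each statement's English description precedes it below -/
import Mathlib

section
/- Let L be an n×n lower unitriangular matrix over GF(2) (L i i = 1, L i j = 0 for i < j), let B be an n×n_r matrix over GF(2), and s : Fin n → ZMod 2. Define a matrix A (n×n_r) and a vector a (length n) recursively by: row 1 of A equals row 1 of B and a_1 = s_1; and for k ≥ 1, row (k+1) of A equals row (k+1) of B plus ∑_{i ∈ C_k} (row i of A), and a_{k+1} = s_{k+1} + ∑_{i ∈ C_k} a_i, where C_k = {i : i ≤ k and L (k+1) i = 1}. Then for every r : Fin n_r → ZMod 2, the vector u = A·r + a satisfies L·u = s + B·r; i.e., the recursion correctly computes the affine expression of the unknown variables in terms of the reference variables. -/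
open Matrix Finset

/-- Forward substitution over GF(2): a vector satisfying the recursion
`x l = b l + ∑_{i < l, L l i = 1} x i` solves the lower unitriangular system `L·x = b`. -/
theorem mulVec_eq_of_forward_substitution {ι : Type*} [Fintype ι] [LinearOrder ι]
    {L : Matrix ι ι (ZMod 2)} (hdiag : ∀ i, L i i = 1) (hupper : ∀ i j, i < j → L i j = 0)
    {x b : ι → ZMod 2}
    (hx : ∀ l, x l = b l + ∑ i ∈ Finset.univ.filter (fun i => i < l ∧ L l i = 1), x i) :
    L.mulVec x = b := by
  ext l
  have hterm : ∀ i, L l i * x i =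
      (if i = l then x i else 0) + (if i < l ∧ L l i = 1 then x i else 0) := by
    intro i
    rcases lt_trichotomy i l with h | rfl | h
    · have hL : ∀ c : ZMod 2, c = 0 ∨ c = 1 := by decide
      rcases hL (L l i) with h' | h' <;> simp [h, h', h.ne]
    · simp [hdiag]
    · simp [hupper l i h, h.ne', h.not_gt]
  have hsum : L.mulVec x l =
      x l + ∑ i ∈ Finset.univ.filter (fun i => i < l ∧ L l i = 1), x i := by
    simp only [Matrix.mulVec, dotProduct, hterm, Finset.sum_add_distrib, Finset.sum_filter,
      Finset.sum_ite_eq', Finset.mem_univ, if_true]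
  rw [hsum, hx l, add_assoc, CharTwo.add_self_eq_zero, add_zero]

/-- Let `L` be lower unitriangular over GF(2). Define the matrix `A` and
vector `a` by the recursion: row `l` of `A` equals row `l` of `B` plus the sum of the
previously computed rows `i` of `A` with `i < l` and `L l i = 1`, and similarly
`a l = s l + ∑_{i < l, L l i = 1} a i` (for the first row this reduces to the base case
`A` row `0` = `B` row `0`, `a 0 = s 0`).  Then for every `r`, the vector `u = A·r + a`
satisfies `L·u = s + B·r`. -/
theorem stmt5 {n nr : ℕ} (L : Matrix (Fin n) (Fin n) (ZMod 2))
    (hdiag : ∀ i, L i i = 1) (hupper : ∀ i j, i < j → L i j = 0)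
    (B : Matrix (Fin n) (Fin nr) (ZMod 2)) (s : Fin n → ZMod 2)
    (A : Matrix (Fin n) (Fin nr) (ZMod 2)) (a : Fin n → ZMod 2)
    (hA : ∀ l : Fin n, ∀ j : Fin nr,
      A l j = B l j + ∑ i ∈ Finset.univ.filter (fun i => i < l ∧ L l i = 1), A i j)
    (ha : ∀ l : Fin n,
      a l = s l + ∑ i ∈ Finset.univ.filter (fun i => i < l ∧ L l i = 1), a i) :
    ∀ r : Fin nr → ZMod 2, L.mulVec (A.mulVec r + a) = s + B.mulVec r := by
  intro r
  have hLA : L * A = B := by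
    ext l j
    exact congrFun (mulVec_eq_of_forward_substitution hdiag hupper
      (x := fun i => A i j) (b := fun i => B i j) fun l => hA l j) l
  rw [Matrix.mulVec_add, Matrix.mulVec_mulVec, hLA,
    mulVec_eq_of_forward_substitution hdiag hupper ha, add_comm]
end

section
/- Let F be the 2×2 matrix over GF(2) with rows (1,0) and (1,1), let F^{⊗n} be its n-fold Kronecker power indexed by binary strings (Fin n → Fin 2) with entries F^{⊗n}(i,j) = ∏_k F (i k) (j k), and let B be the permutation matrix of the bit-reversal permutation on binary strings, i.e., the permutation sending i to i ∘ rev where rev reverses the order of the n coordinates. Then the polar generator matrix G = B · F^{⊗n} is an involution over GF(2): G · G = 1. In particular, if c = Gᵀ·u (the codeword generated from input vector u via cᵀ = uᵀG), then u = Gᵀ·c, i.e., the input vector is recovered from the codeword by the same transform. -/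
open Matrix Finset

/-- The polar kernel `F = [[1,0],[1,1]]` over GF(2). -/
def polarKernel : Matrix (Fin 2) (Fin 2) (ZMod 2) := !![1, 0; 1, 1]

/-- The `n`-fold Kronecker power of `F`, with rows and columns indexed by binary
strings of length `n`: `F^{⊗n}(i, j) = ∏_k F (i k) (j k)`. -/
def kronPow (n : ℕ) : Matrix (Fin n → Fin 2) (Fin n → Fin 2) (ZMod 2) :=
  Matrix.of fun i j => ∏ k, polarKernel (i k) (j k)

/-- The bit-reversal permutation on binary strings of length `n`, sending `i` to
`i ∘ rev` where `rev` reverses the order of the `n` coordinates. -/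
def bitRev (n : ℕ) : Equiv.Perm (Fin n → Fin 2) where
  toFun i := i ∘ Fin.rev
  invFun i := i ∘ Fin.rev
  left_inv i := by funext k; simp [Function.comp]
  right_inv i := by funext k; simp [Function.comp]

/-- The bit-reversal permutation matrix `B_N` over GF(2). -/
def bitRevMatrix (n : ℕ) : Matrix (Fin n → Fin 2) (Fin n → Fin 2) (ZMod 2) :=
  (bitRev n).permMatrix (ZMod 2)

theorem polarKernel_mul_self : polarKernel * polarKernel = 1 := by
  decide

theorem kronPow_mul_self (n : ℕ) : kronPow n * kronPow n = 1 := by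
  ext i j
  have h (k : Fin n) : ∑ b, polarKernel (i k) b * polarKernel b (j k) =
      if i k = j k then 1 else 0 := by
    rw [← Matrix.mul_apply, polarKernel_mul_self, Matrix.one_apply]
  simp only [Matrix.mul_apply, kronPow, Matrix.of_apply, ← Finset.prod_mul_distrib]
  rw [← Fintype.prod_sum fun k b => polarKernel (i k) b * polarKernel b (j k)]
  simp only [h, Matrix.one_apply, Fintype.prod_boole, funext_iff]
  congr

theorem kronPow_bitRev_bitRev (n : ℕ) (i j : Fin n → Fin 2) :
    kronPow n (bitRev n i) (bitRev n j) = kronPow n i j :=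
  Equiv.prod_comp Fin.revPerm fun k => polarKernel (i k) (j k)

theorem bitRevMatrix_mul_self (n : ℕ) : bitRevMatrix n * bitRevMatrix n = 1 := by
  have h : bitRev n * bitRev n = 1 := Equiv.ext (bitRev n).left_inv
  rw [bitRevMatrix, ← Matrix.permMatrix_mul, h, Matrix.permMatrix_one]

theorem bitRevMatrix_mul_kronPow (n : ℕ) :
    bitRevMatrix n * kronPow n = kronPow n * bitRevMatrix n := by
  rw [bitRevMatrix, Equiv.Perm.permMatrix, PEquiv.toMatrix_toPEquiv_mul,
    PEquiv.mul_toMatrix_toPEquiv]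
  ext i j
  simpa only [Equiv.apply_symm_apply, Matrix.submatrix_apply, id] using kronPow_bitRev_bitRev n i ((bitRev n).symm j)

/-- The polar generator matrix `G = B · F^{⊗n}` is an involution over
GF(2): `G · G = 1`. In particular, if `c = Gᵀ·u` then `u = Gᵀ·c`. -/
theorem stmt9 (n : ℕ) :
    bitRevMatrix n * kronPow n * (bitRevMatrix n * kronPow n) = 1 ∧
    (∀ u c : (Fin n → Fin 2) → ZMod 2,
      c = (bitRevMatrix n * kronPow n)ᵀ.mulVec u →
      u = (bitRevMatrix n * kronPow n)ᵀ.mulVec c) := by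
  have h : bitRevMatrix n * kronPow n * (bitRevMatrix n * kronPow n) = 1 := by
    nth_rewrite 2 [bitRevMatrix_mul_kronPow]
    rw [Matrix.mul_assoc, ← Matrix.mul_assoc (kronPow n), kronPow_mul_self, Matrix.one_mul,
      bitRevMatrix_mul_self]
  refine ⟨h, ?_⟩
  rintro u _ rfl
  rw [Matrix.mulVec_mulVec, ← Matrix.transpose_mul, h, Matrix.transpose_one, Matrix.one_mulVec]
end

section
/- Let H be an m×n matrix over GF(2), let i be a row index and j a column index, and suppose row i of H has exactly one nonzero entry, located at column j (a degree-1 check node). Let H' be the matrix obtained from H by deleting row i and column j. Then every x with H·x = 0 satisfies x j = 0, and the map sending x to its restriction to the coordinates other than j is a bijection from {x | H·x = 0} onto {y | H'·y = 0}. Hence the pruning step that removes a degree-1 check node together with its unique neighboring variable node yields a parity check matrix defining the same code (up to deleting the forced-zero coordinate). -/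
open Matrix

theorem Matrix.mulVec_apply_eq_add_sum_subtype_ne {ι κ R : Type*} [Fintype κ] [DecidableEq κ]
    [NonUnitalNonAssocSemiring R] (A : Matrix ι κ R) (x : κ → R) (r : ι) (j : κ) :
    (A *ᵥ x) r = A r j * x j + ∑ c : {c : κ // c ≠ j}, A r c * x c :=
  Fintype.sum_eq_add_sum_subtype_ne (fun c => A r c * x c) j

/-- If row `i` of `H` has exactly one nonzero entry, at column `j`
(a degree-1 check node), then every `x` with `H·x = 0` satisfies `x j = 0`, and deleting
row `i` and column `j` yields a matrix `H'` such that restriction to the coordinates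
other than `j` is a bijection from the null space of `H` onto the null space of `H'`. -/
theorem stmt12 {m n : ℕ} (H : Matrix (Fin m) (Fin n) (ZMod 2)) (i : Fin m) (j : Fin n)
    (hj : H i j ≠ 0) (hrow : ∀ j' : Fin n, j' ≠ j → H i j' = 0) :
    (∀ x : Fin n → ZMod 2, H.mulVec x = 0 → x j = 0) ∧
    Set.BijOn (fun (x : Fin n → ZMod 2) (c : {c : Fin n // c ≠ j}) => x c.1)
      {x : Fin n → ZMod 2 | H.mulVec x = 0}
      {y : {c : Fin n // c ≠ j} → ZMod 2 |
        (Matrix.of fun (r : {r : Fin m // r ≠ i}) (c : {c : Fin n // c ≠ j}) =>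
          H r.1 c.1).mulVec y = 0} := by
  have row_apply (x : Fin n → ZMod 2) : (H *ᵥ x) i = H i j * x j := by
    rw [mulVec_apply_eq_add_sum_subtype_ne H x i j,
      Finset.sum_eq_zero fun c _ => by rw [hrow c c.2, zero_mul], add_zero]
  have forced_zero (x : Fin n → ZMod 2) (hx : H *ᵥ x = 0) : x j = 0 := by
    have h : H i j * x j = 0 := by rw [← row_apply, hx, Pi.zero_apply]
    exact (mul_eq_zero.mp h).resolve_left hj
  refine ⟨forced_zero, ?_, ?_, ?_⟩
  · intro x hx
    funext r
    have h := congrFun hx r.1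
    rwa [mulVec_apply_eq_add_sum_subtype_ne H x r.1 j, forced_zero x hx, mul_zero,
      zero_add] at h
  · intro x hx x' hx' hxx'
    funext c
    by_cases hc : c = j
    · rw [hc, forced_zero x hx, forced_zero x' hx']
    · exact congrFun hxx' ⟨c, hc⟩
  · intro y hy
    let x : Fin n → ZMod 2 := fun c => if hc : c ≠ j then y ⟨c, hc⟩ else 0
    have hxj : x j = 0 := dif_neg (not_not.mpr rfl)
    have hxy (c : {c : Fin n // c ≠ j}) : x c = y c := dif_pos c.2
    refine ⟨x, ?_, funext hxy⟩
    funext r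
    by_cases hr : r = i
    · rw [hr, row_apply, hxj, mul_zero, Pi.zero_apply]
    · rw [mulVec_apply_eq_add_sum_subtype_ne H x r j, hxj, mul_zero, zero_add]
      simp only [hxy]
      exact congrFun hy ⟨r, hr⟩
end

section
/- Let H be an m×n matrix over GF(2), let i be a row index, and suppose row i has exactly two nonzero entries, at distinct columns j and k (a degree-2 check node). Let H' be obtained from H by deleting row i, adding column k to column j (over GF(2)), and deleting column k. Then every x with H·x = 0 satisfies x j = x k, and the map sending x to its restriction to the coordinates other than k is a bijection from {x | H·x = 0} onto {y | H'·y = 0}. Hence the pruning step that removes a degree-2 check node and merges its two neighboring variable nodes yields a parity check matrix defining the same code (with the two merged coordinates identified). -/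
open Matrix

/-- A row supported on two columns `j ≠ k`, with nonzero entries there, checks `x j + x k`. -/
lemma mulVec_apply_of_degree_two {m n : ℕ} (H : Matrix (Fin m) (Fin n) (ZMod 2)) (i : Fin m)
    (j k : Fin n) (hjk : j ≠ k) (hj : H i j ≠ 0) (hk : H i k ≠ 0)
    (hrow : ∀ j' : Fin n, j' ≠ j → j' ≠ k → H i j' = 0) (x : Fin n → ZMod 2) :
    H.mulVec x i = x j + x k := by
  have one_of_ne_zero : ∀ a : ZMod 2, a ≠ 0 → a = 1 := by decide
  rw [Matrix.mulVec, dotProduct, Fintype.sum_eq_add j k hjk, one_of_ne_zero _ hj,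
    one_of_ne_zero _ hk, one_mul, one_mul]
  rintro c ⟨hcj, hck⟩
  rw [hrow c hcj hck, zero_mul]

/-- Merging column `k` into column `j` does not change the product with a vector whose
coordinates `j` and `k` agree. -/
lemma sum_merge_columns {ι R : Type*} [Fintype ι] [DecidableEq ι] [CommSemiring R]
    (a x : ι → R) {j k : ι} (hjk : j ≠ k) (hx : x j = x k) :
    ∑ c : {c : ι // c ≠ k}, (if c.1 = j then a j + a k else a c.1) * x c.1 =
      ∑ c, a c * x c := by
  have split_entry : ∀ c : {c : ι // c ≠ k},
      (if c.1 = j then a j + a k else a c.1) * x c.1 =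
        (if c = ⟨j, hjk⟩ then a k * x k else 0) + a c.1 * x c.1 := by
    rintro ⟨c, hc⟩
    by_cases h : c = j
    · subst h
      simp [hx, add_mul, add_comm]
    · simp [h]
  rw [Fintype.sum_eq_add_sum_subtype_ne _ k, Finset.sum_congr rfl fun c _ => split_entry c,
    Finset.sum_add_distrib]
  simp

/-- If row `i` of `H` has exactly two nonzero entries, at distinct
columns `j` and `k` (a degree-2 check node), then every `x` with `H·x = 0` satisfies
`x j = x k`, and the matrix `H'` obtained by deleting row `i`, adding column `k` to
column `j` and deleting column `k` is such that restriction to the coordinates other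
than `k` is a bijection from the null space of `H` onto the null space of `H'`. -/
theorem stmt13 {m n : ℕ} (H : Matrix (Fin m) (Fin n) (ZMod 2)) (i : Fin m)
    (j k : Fin n) (hjk : j ≠ k)
    (hj : H i j ≠ 0) (hk : H i k ≠ 0)
    (hrow : ∀ j' : Fin n, j' ≠ j → j' ≠ k → H i j' = 0) :
    (∀ x : Fin n → ZMod 2, H.mulVec x = 0 → x j = x k) ∧
    Set.BijOn (fun (x : Fin n → ZMod 2) (c : {c : Fin n // c ≠ k}) => x c.1)
      {x : Fin n → ZMod 2 | H.mulVec x = 0}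
      {y : {c : Fin n // c ≠ k} → ZMod 2 |
        (Matrix.of fun (r : {r : Fin m // r ≠ i}) (c : {c : Fin n // c ≠ k}) =>
          if c.1 = j then H r.1 j + H r.1 k else H r.1 c.1).mulVec y = 0} := by
  have row_eq := mulVec_apply_of_degree_two H i j k hjk hj hk hrow
  have eq_of_mem : ∀ x : Fin n → ZMod 2, H.mulVec x = 0 → x j = x k := fun x hx =>
    CharTwo.add_eq_zero.1 ((row_eq x).symm.trans (congrFun hx i))
  refine ⟨eq_of_mem, ?_, ?_, ?_⟩
  · intro x hx
    funext r
    exact (sum_merge_columns (H r.1) x hjk (eq_of_mem x hx)).trans (congrFun hx r.1)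
  · intro x hx y hy hxy
    have agree : ∀ c, c ≠ k → x c = y c := fun c hc => congrFun hxy ⟨c, hc⟩
    funext c
    by_cases hc : c = k
    · rw [hc, ← eq_of_mem x hx, ← eq_of_mem y hy, agree j hjk]
    · exact agree c hc
  · intro y hy
    let x : Fin n → ZMod 2 := fun c => if h : c = k then y ⟨j, hjk⟩ else y ⟨c, h⟩
    have hx : x j = x k := by simp [x, hjk]
    have restrict_x : (fun c : {c : Fin n // c ≠ k} => x c.1) = y := by
      funext c
      simp [x, c.2]
    refine ⟨x, ?_, restrict_x⟩
    funext r
    by_cases hr : r = i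
    · rw [hr, row_eq, hx, CharTwo.add_self_eq_zero, Pi.zero_apply]
    · rw [← restrict_x] at hy
      exact (sum_merge_columns (H r) x hjk hx).symm.trans (congrFun hy ⟨r, hr⟩)
end

section
/- Let H be an m×n matrix over GF(2), let j be a column index and i a row index, and suppose column j has exactly one nonzero entry, located at row i (a degree-1 hidden variable node). Let H' be obtained from H by deleting row i and column j. Then the map sending x to its restriction to the coordinates other than j is a bijection from {x | H·x = 0} onto {y | H'·y = 0}: every solution of the reduced system extends uniquely to a solution of the original system, the deleted coordinate being determined by row i. Hence the pruning step that removes a degree-1 hidden variable node together with the single check node it touches preserves the solution set projected onto the remaining variables. -/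
open Matrix

/-- Splitting off column `j` in a row of a matrix-vector product. -/
theorem mulVec_apply_eq_add_sum_ne {ι κ R : Type*} [Fintype κ] [DecidableEq κ]
    [NonUnitalNonAssocSemiring R] (H : Matrix ι κ R) (x : κ → R) (r : ι) (j : κ) :
    H.mulVec x r = H r j * x j + ∑ c : {c : κ // c ≠ j}, H r c.1 * x c.1 :=
  Fintype.sum_eq_add_sum_subtype_ne (fun c => H r c * x c) j

/-- If column `j` of `H` has exactly one nonzero entry, at row `i`
(a degree-1 hidden variable node), then deleting row `i` and column `j` yields a matrix
`H'` such that restriction to the coordinates other than `j` is a bijection from the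
null space of `H` onto the null space of `H'`: every solution of the reduced system
extends uniquely to a solution of the original one. -/
theorem stmt14 {m n : ℕ} (H : Matrix (Fin m) (Fin n) (ZMod 2)) (i : Fin m) (j : Fin n)
    (hi : H i j ≠ 0) (hcol : ∀ i' : Fin m, i' ≠ i → H i' j = 0) :
    Set.BijOn (fun (x : Fin n → ZMod 2) (c : {c : Fin n // c ≠ j}) => x c.1)
      {x : Fin n → ZMod 2 | H.mulVec x = 0}
      {y : {c : Fin n // c ≠ j} → ZMod 2 |
        (Matrix.of fun (r : {r : Fin m // r ≠ i}) (c : {c : Fin n // c ≠ j}) =>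
          H r.1 c.1).mulVec y = 0} := by
  refine ⟨fun x hx => ?_, fun x hx x' hx' hxx' => ?_, fun y hy => ?_⟩
  · funext r
    have h := congrFun (show H.mulVec x = 0 from hx) r.1
    rw [mulVec_apply_eq_add_sum_ne H x r.1 j, hcol r.1 r.2, zero_mul, zero_add] at h
    exact h
  · have hne : ∀ c, c ≠ j → x c = x' c := fun c hc => congrFun hxx' ⟨c, hc⟩
    have h := congrFun (show H.mulVec x = H.mulVec x' from Eq.trans hx (Eq.symm hx')) i
    rw [mulVec_apply_eq_add_sum_ne H x i j, mulVec_apply_eq_add_sum_ne H x' i j,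
      Finset.sum_congr rfl fun (c : {c : Fin n // c ≠ j}) _ => by rw [hne c.1 c.2]] at h
    funext c
    by_cases hc : c = j
    · rw [hc]
      exact mul_left_cancel₀ hi (add_right_cancel h)
    · exact hne c hc
  · let x : Fin n → ZMod 2 := fun c =>
      if hc : c = j then -((H i j)⁻¹ * ∑ c : {c : Fin n // c ≠ j}, H i c.1 * y c)
      else y ⟨c, hc⟩
    have hxj : x j = -((H i j)⁻¹ * ∑ c : {c : Fin n // c ≠ j}, H i c.1 * y c) := dif_pos rfl
    have hxc : ∀ c : {c : Fin n // c ≠ j}, x c.1 = y c := fun c => dif_neg c.2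
    refine ⟨x, ?_, funext hxc⟩
    funext r
    rw [mulVec_apply_eq_add_sum_ne H x r j]
    simp only [hxc, Pi.zero_apply]
    by_cases hr : r = i
    · rw [hr, hxj, mul_neg, mul_inv_cancel_left₀ hi, neg_add_cancel]
    · rw [hcol r hr, zero_mul, zero_add]
      exact congrFun hy ⟨r, hr⟩
end
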